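/- arXiv:1911.00308 — 2 statements merged into one kernel-verified Lean document; each statement's English description precedes it below -/
import Mathlib

section
/- Suppose the system x_{k+1} = A(ξ_k) x_k satisfies Assumption 3 (essential boundedness). Then the following two conditions are equivalent. (1) There exist ε̲₂, ε̄₂, ε₂ > 0, λ₂ ∈ (0,1), and a measurable R : (ℝ^Z)^ℕ → Sym_n(ℝ) such that, writing R_k := R((ξ_{k+t})_{t∈ℕ}), for every k₀ ∈ ℤ: ε̲₂ I ≼ E[R_{k₀} | 𝒢_{k₀}] ≼ ε̄₂ I a.s. and λ₂² E[R_{k₀} | 𝒢_{k₀}] − A(ξ_{k₀})ᵀ E[R_{k₀+1} | 𝒢_{k₀}] A(ξ_{k₀}) ≽ ε₂ I a.s. (2) There exist ε̲₂, ε̄₂, ε₂ > 0 and a measurable R : (ℝ^Z)^ℕ → Sym_n(ℝ) such that, for every k₀ ∈ ℤ: ε̲₂ I ≼ E[R_{k₀} | 𝒢_{k₀}] ≼ ε̄₂ I a.s. and E[R_{k₀} | 𝒢_{k₀}] − A(ξ_{k₀})ᵀ E[R_{k₀+1} | 𝒢_{k₀}] A(ξ_{k₀}) ≽ ε₂ I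 a.s. -/
open MeasureTheory Matrix ProbabilityTheory

noncomputable section

namespace SMS

variable {Ω : Type} [MeasurableSpace Ω]

/-- The σ-algebra generated by the random vectors `ξ t` for `t ≤ k`. -/
def pastSigma {Z : ℕ} (ξ : ℤ → Ω → (Fin Z → ℝ)) (k : ℤ) : MeasurableSpace Ω :=
  ⨆ t : {t : ℤ // t ≤ k}, MeasurableSpace.comap (ξ t.1) inferInstance

/-- The σ-algebra generated by a single random vector. -/
def sigmaOf {Z : ℕ} (η : Ω → (Fin Z → ℝ)) : MeasurableSpace Ω :=
  MeasurableSpace.comap η inferInstance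

/-- The state `x_{k₀+m}` of the system `x_{k+1} = A(ξ_k) x_k` with `x_{k₀} = x0`. -/
def state {n Z : ℕ} (A : (Fin Z → ℝ) → Matrix (Fin n) (Fin n) ℝ)
    (ξ : ℤ → Ω → (Fin Z → ℝ)) (k₀ : ℤ) (x0 : Fin n → ℝ) : ℕ → Ω → (Fin n → ℝ)
  | 0 => fun _ => x0
  | (m + 1) => fun ω => (A (ξ (k₀ + m) ω)).mulVec (state A ξ k₀ x0 m ω)

/-- Squared Euclidean norm. -/
def sqNorm {n : ℕ} (v : Fin n → ℝ) : ℝ := ∑ i, (v i) ^ 2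

/-- Conditional second moment `E[‖x_{k₀+m}‖² | 𝒢_{k₀-1}]` as a function on `Ω`. -/
def smom {n Z : ℕ} (μ : Measure Ω) (A : (Fin Z → ℝ) → Matrix (Fin n) (Fin n) ℝ)
    (ξ : ℤ → Ω → (Fin Z → ℝ)) (k₀ : ℤ) (x0 : Fin n → ℝ) (m : ℕ) : Ω → ℝ :=
  μ[(fun ω => sqNorm (state A ξ k₀ x0 m ω)) | pastSigma ξ (k₀ - 1)]

/-- Assumption 1: conditionally bounded second moments of the entries of `A(ξ_{k₀})`. -/
def Assumption1 {n Z : ℕ} (μ : Measure Ω) (A : (Fin Z → ℝ) → Matrix (Fin n) (Fin n) ℝ)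
    (ξ : ℤ → Ω → (Fin Z → ℝ)) : Prop :=
  ∀ k₀ : ℤ, ∃ M₁ : ℝ, 0 < M₁ ∧ ∀ i j : Fin n,
    ∀ᵐ ω ∂μ, (μ[(fun ω' => (A (ξ k₀ ω') i j) ^ 2) | pastSigma ξ (k₀ - 1)]) ω ≤ M₁

/-- Assumption 2: (strict) stationarity of the process `ξ`. -/
def Stationary {Z : ℕ} (μ : Measure Ω) (ξ : ℤ → Ω → (Fin Z → ℝ)) : Prop :=
  ∀ s : ℤ, Measure.map (fun ω => fun k : ℤ => ξ (k + s) ω) μ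
    = Measure.map (fun ω => fun k : ℤ => ξ k ω) μ

/-- N-periodic stationarity of the process `ξ`. -/
def PeriodicStationary {Z : ℕ} (μ : Measure Ω) (ξ : ℤ → Ω → (Fin Z → ℝ)) (N : ℕ) : Prop :=
  Measure.map (fun ω => fun k : ℤ => ξ (k + N) ω) μ = Measure.map (fun ω => fun k : ℤ => ξ k ω) μ

/-- Assumption 3: essential boundedness of the entries of the coefficient matrices. -/
def Assumption3 {n Z : ℕ} (μ : Measure Ω) (A : (Fin Z → ℝ) → Matrix (Fin n) (Fin n) ℝ)
    (ξ : ℤ → Ω → (Fin Z → ℝ)) : Prop :=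
  ∃ M₃ : ℝ, 0 < M₃ ∧ ∀ k : ℤ, ∀ i j : Fin n, ∀ᵐ ω ∂μ, |A (ξ k ω) i j| < M₃

/-- Markov property of `ξ`. -/
def MarkovProp {Z : ℕ} (μ : Measure Ω) (ξ : ℤ → Ω → (Fin Z → ℝ)) : Prop :=
  ∀ i j : ℤ, i < j → ∀ f : (Fin Z → ℝ) → ℝ, Measurable f → (∃ C : ℝ, ∀ v, |f v| ≤ C) →
    (μ[(fun ω => f (ξ j ω)) | pastSigma ξ i]) =ᵐ[μ] (μ[(fun ω => f (ξ j ω)) | sigmaOf (ξ i)])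

/-- Exponential stability in the second moment, with given rate `lam`. -/
def ExpStableWith {n Z : ℕ} (μ : Measure Ω) (A : (Fin Z → ℝ) → Matrix (Fin n) (Fin n) ℝ)
    (ξ : ℤ → Ω → (Fin Z → ℝ)) (lam : ℝ) : Prop :=
  ∃ a : ℝ, 0 < a ∧ ∀ k₀ : ℤ, ∀ x0 : Fin n → ℝ, ∀ m : ℕ,
    ∀ᵐ ω ∂μ, smom μ A ξ k₀ x0 m ω ≤ a * sqNorm x0 * lam ^ (2 * m)

/-- Exponential stability in the second moment. -/
def ExpStable {n Z : ℕ} (μ : Measure Ω) (A : (Fin Z → ℝ) → Matrix (Fin n) (Fin n) ℝ)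
    (ξ : ℤ → Ω → (Fin Z → ℝ)) : Prop :=
  ∃ lam : ℝ, 0 < lam ∧ lam < 1 ∧ ExpStableWith μ A ξ lam

/-- Stability in the second moment. -/
def Stable {n Z : ℕ} (μ : Measure Ω) (A : (Fin Z → ℝ) → Matrix (Fin n) (Fin n) ℝ)
    (ξ : ℤ → Ω → (Fin Z → ℝ)) : Prop :=
  ∀ ε : ℝ, 0 < ε → ∀ k₀ : ℤ, ∃ δ : ℝ, 0 < δ ∧ ∀ x0 : Fin n → ℝ, sqNorm x0 ≤ δ →
    ∀ m : ℕ, ∀ᵐ ω ∂μ, smom μ A ξ k₀ x0 m ω ≤ ε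

/-- Uniform stability in the second moment. -/
def UnifStable {n Z : ℕ} (μ : Measure Ω) (A : (Fin Z → ℝ) → Matrix (Fin n) (Fin n) ℝ)
    (ξ : ℤ → Ω → (Fin Z → ℝ)) : Prop :=
  ∀ ε : ℝ, 0 < ε → ∃ δ : ℝ, 0 < δ ∧ ∀ k₀ : ℤ, ∀ x0 : Fin n → ℝ, sqNorm x0 ≤ δ →
    ∀ m : ℕ, ∀ᵐ ω ∂μ, smom μ A ξ k₀ x0 m ω ≤ ε

/-- Uniform attractivity in the second moment. -/
def Attractive {n Z : ℕ} (μ : Measure Ω) (A : (Fin Z → ℝ) → Matrix (Fin n) (Fin n) ℝ)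
    (ξ : ℤ → Ω → (Fin Z → ℝ)) : Prop :=
  ∀ ε : ℝ, 0 < ε → ∃ K : ℕ, ∀ k₀ : ℤ, ∀ x0 : Fin n → ℝ, ∀ m : ℕ, K ≤ m →
    ∀ᵐ ω ∂μ, smom μ A ξ k₀ x0 m ω ≤ ε * sqNorm x0

/-- Uniform asymptotic stability in the second moment. -/
def UnifAsympStable {n Z : ℕ} (μ : Measure Ω) (A : (Fin Z → ℝ) → Matrix (Fin n) (Fin n) ℝ)
    (ξ : ℤ → Ω → (Fin Z → ℝ)) : Prop :=
  UnifStable μ A ξ ∧ Attractive μ A ξ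

/-- Asymptotic stability in the second moment. -/
def AsympStable {n Z : ℕ} (μ : Measure Ω) (A : (Fin Z → ℝ) → Matrix (Fin n) (Fin n) ℝ)
    (ξ : ℤ → Ω → (Fin Z → ℝ)) : Prop :=
  Stable μ A ξ ∧ ∀ k₀ : ℤ, ∀ x0 : Fin n → ℝ,
    ∀ᵐ ω ∂μ, Filter.Tendsto (fun m => smom μ A ξ k₀ x0 m ω) Filter.atTop (nhds 0)

/-- Quadratic stability. -/
def QuadStable {n Z : ℕ} (μ : Measure Ω) (A : (Fin Z → ℝ) → Matrix (Fin n) (Fin n) ℝ)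
    (ξ : ℤ → Ω → (Fin Z → ℝ)) : Prop :=
  ∃ P₀ : Matrix (Fin n) (Fin n) ℝ, P₀.PosDef ∧ ∃ lam : ℝ, 0 < lam ∧ lam < 1 ∧
    ∀ k₀ : ℤ, ∀ x0 : Fin n → ℝ, ∀ m : ℕ, ∀ᵐ ω ∂μ,
      (μ[(fun ω' => state A ξ k₀ x0 (m + 1) ω' ⬝ᵥ P₀.mulVec (state A ξ k₀ x0 (m + 1) ω'))
          | pastSigma ξ (k₀ - 1)]) ω
      ≤ lam ^ 2 * (μ[(fun ω' => state A ξ k₀ x0 m ω' ⬝ᵥ P₀.mulVec (state A ξ k₀ x0 m ω'))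
          | pastSigma ξ (k₀ - 1)]) ω

/-- Entrywise conditional expectation of a random matrix. -/
def condExpM {n : ℕ} (μ : Measure Ω) (m : MeasurableSpace Ω)
    (M : Ω → Matrix (Fin n) (Fin n) ℝ) : Ω → Matrix (Fin n) (Fin n) ℝ :=
  fun ω => Matrix.of fun i j => (μ[(fun ω' => M ω' i j) | m]) ω

/-- Entrywise expectation of a random matrix. -/
def expM {n : ℕ} (μ : Measure Ω) (M : Ω → Matrix (Fin n) (Fin n) ℝ) :
    Matrix (Fin n) (Fin n) ℝ :=
  Matrix.of fun i j => ∫ ω, M ω i j ∂μ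

/-- The forward path `(ξ_{k+t})_{t ∈ ℕ}` of the process `ξ` from time `k`. -/
def pathFrom {Z : ℕ} (ξ : ℤ → Ω → (Fin Z → ℝ)) (k : ℤ) : Ω → (ℕ → Fin Z → ℝ) :=
  fun ω t => ξ (k + t) ω

/-- Condition (P) with decay rate `lam`: the Lyapunov inequality
`E₀[λ₁² P_{k₀} − A(ξ_{k₀})ᵀ E₀[P_{k₀+1} | 𝒢_{k₀}] A(ξ_{k₀})] ≽ 0` together with the uniform
bounds `ε̲₁ I ≼ E₀[P_{k₀}] ≼ ε̄₁ I`. -/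
def CondP {n Z : ℕ} (μ : Measure Ω) (A : (Fin Z → ℝ) → Matrix (Fin n) (Fin n) ℝ)
    (ξ : ℤ → Ω → (Fin Z → ℝ)) (lam : ℝ) : Prop :=
  ∃ el eu : ℝ, 0 < el ∧ 0 < eu ∧
    ∃ P : (ℕ → Fin Z → ℝ) → Matrix (Fin n) (Fin n) ℝ,
      (∀ i j : Fin n, Measurable fun v => P v i j) ∧ (∀ v, (P v).IsSymm) ∧
      ∀ k₀ : ℤ,
        (∀ᵐ ω ∂μ, (condExpM μ (pastSigma ξ (k₀ - 1)) (fun ω' => P (pathFrom ξ k₀ ω')) ω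
            - el • (1 : Matrix (Fin n) (Fin n) ℝ)).PosSemidef) ∧
        (∀ᵐ ω ∂μ, (eu • (1 : Matrix (Fin n) (Fin n) ℝ)
            - condExpM μ (pastSigma ξ (k₀ - 1)) (fun ω' => P (pathFrom ξ k₀ ω')) ω).PosSemidef) ∧
        (∀ᵐ ω ∂μ, (condExpM μ (pastSigma ξ (k₀ - 1)) (fun ω' =>
            lam ^ 2 • P (pathFrom ξ k₀ ω')
            - (A (ξ k₀ ω'))ᵀ
              * condExpM μ (pastSigma ξ k₀) (fun ω'' => P (pathFrom ξ (k₀ + 1) ω'')) ω'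
              * (A (ξ k₀ ω'))) ω).PosSemidef)

/-- Condition (P) without decay rate: the strict Lyapunov inequality
`E₀[P_{k₀} − A(ξ_{k₀})ᵀ E₀[P_{k₀+1} | 𝒢_{k₀}] A(ξ_{k₀})] ≽ ε₁ I`. -/
def CondPstrict {n Z : ℕ} (μ : Measure Ω) (A : (Fin Z → ℝ) → Matrix (Fin n) (Fin n) ℝ)
    (ξ : ℤ → Ω → (Fin Z → ℝ)) : Prop :=
  ∃ el eu ep : ℝ, 0 < el ∧ 0 < eu ∧ 0 < ep ∧
    ∃ P : (ℕ → Fin Z → ℝ) → Matrix (Fin n) (Fin n) ℝ,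
      (∀ i j : Fin n, Measurable fun v => P v i j) ∧ (∀ v, (P v).IsSymm) ∧
      ∀ k₀ : ℤ,
        (∀ᵐ ω ∂μ, (condExpM μ (pastSigma ξ (k₀ - 1)) (fun ω' => P (pathFrom ξ k₀ ω')) ω
            - el • (1 : Matrix (Fin n) (Fin n) ℝ)).PosSemidef) ∧
        (∀ᵐ ω ∂μ, (eu • (1 : Matrix (Fin n) (Fin n) ℝ)
            - condExpM μ (pastSigma ξ (k₀ - 1)) (fun ω' => P (pathFrom ξ k₀ ω')) ω).PosSemidef) ∧
        (∀ᵐ ω ∂μ, (condExpM μ (pastSigma ξ (k₀ - 1)) (fun ω' =>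
            P (pathFrom ξ k₀ ω')
            - (A (ξ k₀ ω'))ᵀ
              * condExpM μ (pastSigma ξ k₀) (fun ω'' => P (pathFrom ξ (k₀ + 1) ω'')) ω'
              * (A (ξ k₀ ω'))) ω - ep • (1 : Matrix (Fin n) (Fin n) ℝ)).PosSemidef)

/-- Condition (R) with decay rate `lam` (for essentially bounded coefficients). -/
def CondR {n Z : ℕ} (μ : Measure Ω) (A : (Fin Z → ℝ) → Matrix (Fin n) (Fin n) ℝ)
    (ξ : ℤ → Ω → (Fin Z → ℝ)) (lam : ℝ) : Prop :=
  ∃ el eu ep : ℝ, 0 < el ∧ 0 < eu ∧ 0 < ep ∧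
    ∃ R : (ℕ → Fin Z → ℝ) → Matrix (Fin n) (Fin n) ℝ,
      (∀ i j : Fin n, Measurable fun v => R v i j) ∧ (∀ v, (R v).IsSymm) ∧
      ∀ k₀ : ℤ,
        (∀ᵐ ω ∂μ, (condExpM μ (pastSigma ξ k₀) (fun ω' => R (pathFrom ξ k₀ ω')) ω
            - el • (1 : Matrix (Fin n) (Fin n) ℝ)).PosSemidef) ∧
        (∀ᵐ ω ∂μ, (eu • (1 : Matrix (Fin n) (Fin n) ℝ)
            - condExpM μ (pastSigma ξ k₀) (fun ω' => R (pathFrom ξ k₀ ω')) ω).PosSemidef) ∧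
        (∀ᵐ ω ∂μ, (lam ^ 2 • condExpM μ (pastSigma ξ k₀) (fun ω' => R (pathFrom ξ k₀ ω')) ω
            - (A (ξ k₀ ω))ᵀ
              * condExpM μ (pastSigma ξ k₀) (fun ω' => R (pathFrom ξ (k₀ + 1) ω')) ω
              * (A (ξ k₀ ω))
            - ep • (1 : Matrix (Fin n) (Fin n) ℝ)).PosSemidef)

/-- Condition (R) without decay rate. -/
def CondRstrict {n Z : ℕ} (μ : Measure Ω) (A : (Fin Z → ℝ) → Matrix (Fin n) (Fin n) ℝ)
    (ξ : ℤ → Ω → (Fin Z → ℝ)) : Prop :=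
  ∃ el eu ep : ℝ, 0 < el ∧ 0 < eu ∧ 0 < ep ∧
    ∃ R : (ℕ → Fin Z → ℝ) → Matrix (Fin n) (Fin n) ℝ,
      (∀ i j : Fin n, Measurable fun v => R v i j) ∧ (∀ v, (R v).IsSymm) ∧
      ∀ k₀ : ℤ,
        (∀ᵐ ω ∂μ, (condExpM μ (pastSigma ξ k₀) (fun ω' => R (pathFrom ξ k₀ ω')) ω
            - el • (1 : Matrix (Fin n) (Fin n) ℝ)).PosSemidef) ∧
        (∀ᵐ ω ∂μ, (eu • (1 : Matrix (Fin n) (Fin n) ℝ)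
            - condExpM μ (pastSigma ξ k₀) (fun ω' => R (pathFrom ξ k₀ ω')) ω).PosSemidef) ∧
        (∀ᵐ ω ∂μ, (condExpM μ (pastSigma ξ k₀) (fun ω' => R (pathFrom ξ k₀ ω')) ω
            - (A (ξ k₀ ω))ᵀ
              * condExpM μ (pastSigma ξ k₀) (fun ω' => R (pathFrom ξ (k₀ + 1) ω')) ω
              * (A (ξ k₀ ω))
            - ep • (1 : Matrix (Fin n) (Fin n) ℝ)).PosSemidef)

theorem condR_iff_condRstrict {n Z : ℕ} (hn : 0 < n) (hZ : 0 < Z) {Ω : Type} [MeasurableSpace Ω]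
    (μ : Measure Ω) [IsProbabilityMeasure μ]
    (A : (Fin Z → ℝ) → Matrix (Fin n) (Fin n) ℝ)
    (hA : ∀ i j : Fin n, Measurable fun v => A v i j)
    (ξ : ℤ → Ω → (Fin Z → ℝ)) (hξ : ∀ k : ℤ, Measurable (ξ k))
    (h3 : Assumption3 μ A ξ) :
    (∃ lam : ℝ, 0 < lam ∧ lam < 1 ∧ CondR μ A ξ lam) ↔ CondRstrict μ A ξ := by
  constructor
  · rintro ⟨lam, h0, h1, el, eu, ep, hel, heu, hep, R, hm, hs, h⟩
    refine ⟨el, eu, ep, hel, heu, hep, R, hm, hs, fun k₀ => ?_⟩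
    obtain ⟨ha, hb, hc⟩ := h k₀
    refine ⟨ha, hb, ?_⟩
    filter_upwards [ha, hc] with ω ha hc
    have hl : 0 ≤ 1 - lam ^ 2 := by nlinarith
    have h2 : 0 ≤ (1 - lam ^ 2) * el := mul_nonneg hl hel.le
    have key := (hc.add (ha.smul hl)).add
      ((Matrix.PosSemidef.one (n := Fin n) (R := ℝ)).smul h2)
    convert key using 1
    module
  · rintro ⟨el, eu, ep, hel, heu, hep, R, hm, hs, h⟩
    obtain ⟨c, hc0, hc1, hc2⟩ : ∃ c : ℝ, 0 < c ∧ c < 1 ∧ c * eu ≤ ep / 2 := by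
      refine ⟨min (1 / 2) (ep / 2 / eu), lt_min (by norm_num) (by positivity),
        (min_le_left _ _).trans_lt (by norm_num), ?_⟩
      exact (le_div_iff₀ heu).1 (min_le_right _ _)
    have hsq : Real.sqrt (1 - c) ^ 2 = 1 - c := Real.sq_sqrt (by linarith)
    refine ⟨Real.sqrt (1 - c), Real.sqrt_pos.2 (by linarith), ?_, el, eu, ep / 2, hel, heu,
      by positivity, R, hm, hs, fun k₀ => ?_⟩
    · rw [Real.sqrt_lt' one_pos]
      linarith
    obtain ⟨ha, hb, hd⟩ := h k₀
    refine ⟨ha, hb, ?_⟩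
    filter_upwards [hb, hd] with ω hb hd
    have h2 : 0 ≤ ep / 2 - c * eu := by linarith
    have key := (hd.add (hb.smul hc0.le)).add
      ((Matrix.PosSemidef.one (n := Fin n) (R := ℝ)).smul h2)
    rw [hsq]
    convert key using 1
    module

end SMS

end
end

section
/- Suppose the system x_{k+1} = A(ξ_k) x_k satisfies Assumptions 2 and 3 and ξ has the Markov property. Then the system is exponentially stable in the second moment if and only if there exist ε̲₂, ε̄₂, ε₂ > 0, λ₂ ∈ (0,1), and a Borel-measurable R₀ : ℝ^Z → Sym_n(ℝ) such that ε̲₂ I ≼ R₀(ξ_{−1}) ≼ ε̄₂ I a.s. and λ₂² R₀(ξ_{−1}) − A(ξ_{−1})ᵀ E[R₀(ξ₀) | σ(ξ_{−1})] A(ξ_{−1}) ≽ ε₂ I a.s., where σ(ξ_{−1}) is the σ-algebra generated by ξ_{−1}. -/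
open MeasureTheory Matrix ProbabilityTheory

noncomputable section

namespace SMS

variable {Ω : Type} [MeasurableSpace Ω]

/-! ### Helper material -/

/-- Quadratic form. -/
def qf {n : ℕ} (x : Fin n → ℝ) (M : Matrix (Fin n) (Fin n) ℝ) : ℝ :=
  ∑ i, ∑ j, x i * x j * M i j

lemma qf_eq {n : ℕ} (x : Fin n → ℝ) (M : Matrix (Fin n) (Fin n) ℝ) :
    qf x M = x ⬝ᵥ M *ᵥ x := by
  simp only [qf, dotProduct, mulVec, Finset.mul_sum]
  refine Finset.sum_congr rfl fun i _ => Finset.sum_congr rfl fun j _ => ?_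
  ring

lemma qf_conj {n : ℕ} (x : Fin n → ℝ) (B M : Matrix (Fin n) (Fin n) ℝ) :
    qf x (Bᵀ * M * B) = qf (B *ᵥ x) M := by
  rw [qf_eq, qf_eq, ← mulVec_mulVec, ← mulVec_mulVec, dotProduct_mulVec, vecMul_transpose]

lemma qf_sub {n : ℕ} (x : Fin n → ℝ) (M N : Matrix (Fin n) (Fin n) ℝ) :
    qf x (M - N) = qf x M - qf x N := by
  simp [qf_eq, sub_mulVec]

lemma qf_add {n : ℕ} (x : Fin n → ℝ) (M N : Matrix (Fin n) (Fin n) ℝ) :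
    qf x (M + N) = qf x M + qf x N := by
  simp [qf_eq, add_mulVec]

lemma qf_smul {n : ℕ} (x : Fin n → ℝ) (c : ℝ) (M : Matrix (Fin n) (Fin n) ℝ) :
    qf x (c • M) = c * qf x M := by
  simp [qf_eq, smul_mulVec]

lemma qf_one {n : ℕ} (x : Fin n → ℝ) : qf x (1 : Matrix (Fin n) (Fin n) ℝ) = sqNorm x := by
  simp [qf_eq, sqNorm, dotProduct, sq]

lemma qf_sum {n : ℕ} {ι : Type} (s : Finset ι) (x : Fin n → ℝ)
    (M : ι → Matrix (Fin n) (Fin n) ℝ) :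
    qf x (∑ i ∈ s, M i) = ∑ i ∈ s, qf x (M i) := by
  classical
  induction s using Finset.induction_on with
  | empty => simp [qf]
  | insert a s ha ih => rw [Finset.sum_insert ha, Finset.sum_insert ha, qf_add, ih]

lemma sqNorm_nonneg {n : ℕ} (x : Fin n → ℝ) : 0 ≤ sqNorm x :=
  Finset.sum_nonneg fun _ _ => sq_nonneg _

lemma psd_iff {n : ℕ} (M : Matrix (Fin n) (Fin n) ℝ) (hM : M.IsSymm) :
    M.PosSemidef ↔ ∀ x, 0 ≤ qf x M := by
  constructor
  · intro h x
    rw [qf_eq]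
    simpa using h.dotProduct_mulVec_nonneg x
  · intro h
    refine PosSemidef.of_dotProduct_mulVec_nonneg ?_ ?_
    · rw [IsHermitian, conjTranspose_eq_transpose_of_trivial]; exact hM
    · intro x
      rw [star_trivial, ← qf_eq]; exact h x

lemma psd_qf {n : ℕ} {M : Matrix (Fin n) (Fin n) ℝ} (h : M.PosSemidef) (x : Fin n → ℝ) :
    0 ≤ qf x M := by
  rw [qf_eq]
  simpa using h.dotProduct_mulVec_nonneg x

lemma continuous_qf_vec {n : ℕ} (M : Matrix (Fin n) (Fin n) ℝ) : Continuous fun x => qf x M := by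
  unfold qf; fun_prop

lemma continuous_qf_mat {n : ℕ} (x : Fin n → ℝ) :
    Continuous fun M : Fin n → Fin n → ℝ => qf x M := by
  unfold qf; fun_prop

lemma measurableSet_qf {n : ℕ} {α : Type} [MeasurableSpace α]
    (Q : α → Matrix (Fin n) (Fin n) ℝ) (hQ : ∀ i j, Measurable fun v => Q v i j) :
    MeasurableSet {v | ∀ x, 0 ≤ qf x (Q v)} := by
  have hc : IsClosed (⋂ x : Fin n → ℝ, {M : Fin n → Fin n → ℝ | 0 ≤ qf x M}) :=
    isClosed_iInter fun x => isClosed_le continuous_const (continuous_qf_mat x)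
  have hm : Measurable (fun v i j => Q v i j : α → Fin n → Fin n → ℝ) :=
    measurable_pi_lambda _ fun i => measurable_pi_lambda _ fun j => hQ i j
  convert hm hc.measurableSet using 1
  ext v
  rw [Set.mem_preimage, Set.mem_iInter]
  rfl

lemma ae_all_qf {n : ℕ} (μ : Measure Ω) (Q : Ω → Matrix (Fin n) (Fin n) ℝ)
    (h : ∀ x, ∀ᵐ ω ∂μ, 0 ≤ qf x (Q ω)) : ∀ᵐ ω ∂μ, ∀ x, 0 ≤ qf x (Q ω) := by
  have h' : ∀ᵐ ω ∂μ, ∀ k : ℕ, 0 ≤ qf (TopologicalSpace.denseSeq (Fin n → ℝ) k) (Q ω) :=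
    ae_all_iff.2 fun k => h _
  filter_upwards [h'] with ω hω x
  refine (TopologicalSpace.denseRange_denseSeq (Fin n → ℝ)).induction_on
    (p := fun x => 0 ≤ qf x (Q ω)) x ?_ hω
  exact isClosed_le continuous_const (continuous_qf_vec _)

lemma psd_entry {n : ℕ} {M : Matrix (Fin n) (Fin n) ℝ} {c : ℝ}
    (hs : M.IsSymm) (h0 : ∀ x, 0 ≤ qf x M) (h1 : ∀ x, qf x M ≤ c * sqNorm x) (i j : Fin n) :
    |M i j| ≤ c := by
  classical
  have hs' : M j i = M i j := hs.apply i j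
  have key : ∀ s : ℝ, qf (Pi.single i 1 + s • Pi.single j 1) M
      = M i i + s * M i j + s * M j i + s ^ 2 * M j j := by
    intro s
    rw [qf_eq]
    simp [mulVec_add, mulVec_smul, add_dotProduct, mulVec_single, single_dotProduct]
    ring
  have d : ∀ i, M i i ≤ c := by
    intro i
    have := h1 (Pi.single i 1)
    have e1 : qf (Pi.single i 1) M = M i i := by
      rw [qf_eq]; simp [mulVec_single]
    have e2 : sqNorm (Pi.single i 1 : Fin n → ℝ) = 1 := by
      rw [← qf_one, qf_eq]; simp [mulVec_single]
    rw [e1, e2] at this; linarith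
  have k1 := h0 (Pi.single i 1 + (1:ℝ) • Pi.single j 1)
  have k2 := h0 (Pi.single i 1 + (-1:ℝ) • Pi.single j 1)
  rw [key] at k1 k2
  have := d i
  have := d j
  rw [abs_le]; constructor <;> nlinarith

/-- Bounded measurable matrix-valued functions. -/
def BM {n : ℕ} {α : Type} [MeasurableSpace α] (Q : α → Matrix (Fin n) (Fin n) ℝ) : Prop :=
  (∀ i j, Measurable fun v => Q v i j) ∧ ∃ C : ℝ, ∀ v i j, |Q v i j| ≤ C

/-- Bounded measurable real functions. -/
def BS {α : Type} [MeasurableSpace α] (f : α → ℝ) : Prop :=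
  Measurable f ∧ ∃ C : ℝ, ∀ v, |f v| ≤ C

lemma BS.mul {α : Type} [MeasurableSpace α] {f g : α → ℝ} (hf : BS f) (hg : BS g) :
    BS fun v => f v * g v := by
  obtain ⟨hf, C, hC⟩ := hf
  obtain ⟨hg, D, hD⟩ := hg
  refine ⟨hf.mul hg, C * D, fun v => ?_⟩
  rw [abs_mul]
  exact mul_le_mul (hC v) (hD v) (abs_nonneg _) ((abs_nonneg _).trans (hC v))

lemma BS.add {α : Type} [MeasurableSpace α] {f g : α → ℝ} (hf : BS f) (hg : BS g) :
    BS fun v => f v + g v := by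
  obtain ⟨hf, C, hC⟩ := hf
  obtain ⟨hg, D, hD⟩ := hg
  exact ⟨hf.add hg, C + D, fun v => (abs_add_le _ _).trans (add_le_add (hC v) (hD v))⟩

lemma BS.const {α : Type} [MeasurableSpace α] (c : ℝ) : BS fun _ : α => c :=
  ⟨measurable_const, |c|, fun _ => le_rfl⟩

lemma BS.sum {α ι : Type} [MeasurableSpace α] (s : Finset ι) {f : ι → α → ℝ}
    (hf : ∀ i, BS (f i)) : BS fun v => ∑ i ∈ s, f i v := by
  classical
  induction s using Finset.induction_on with
  | empty => simpa using BS.const 0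
  | insert a s ha ih => simp only [Finset.sum_insert ha]; exact (hf a).add ih

lemma BM_iff {n : ℕ} {α : Type} [MeasurableSpace α] {Q : α → Matrix (Fin n) (Fin n) ℝ} :
    BM Q ↔ ∀ i j, BS fun v => Q v i j := by
  constructor
  · rintro ⟨h, C, hC⟩ i j
    exact ⟨h i j, C, fun v => hC v i j⟩
  · intro h
    refine ⟨fun i j => (h i j).1, ?_⟩
    choose C hC using fun i j => (h i j).2
    refine ⟨∑ i, ∑ j, |C i j|, fun v i j => ?_⟩
    calc |Q v i j| ≤ |C i j| := (hC i j v).trans (le_abs_self _)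
      _ ≤ ∑ j, |C i j| := Finset.single_le_sum (f := fun j => |C i j|)
          (fun _ _ => abs_nonneg _) (Finset.mem_univ j)
      _ ≤ ∑ i, ∑ j, |C i j| := Finset.single_le_sum (f := fun i => ∑ j, |C i j|)
          (fun _ _ => Finset.sum_nonneg fun _ _ => abs_nonneg _) (Finset.mem_univ i)

lemma BM.mul {n : ℕ} {α : Type} [MeasurableSpace α] {P Q : α → Matrix (Fin n) (Fin n) ℝ}
    (hP : BM P) (hQ : BM Q) : BM fun v => P v * Q v := by
  rw [BM_iff] at *
  intro i j
  simp only [Matrix.mul_apply]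
  exact BS.sum _ fun k => (hP i k).mul (hQ k j)

lemma BM.transpose {n : ℕ} {α : Type} [MeasurableSpace α] {P : α → Matrix (Fin n) (Fin n) ℝ}
    (hP : BM P) : BM fun v => (P v)ᵀ := by
  rw [BM_iff] at *
  exact fun i j => hP j i

lemma BM.const {n : ℕ} {α : Type} [MeasurableSpace α] (M : Matrix (Fin n) (Fin n) ℝ) :
    BM fun _ : α => M := by
  rw [BM_iff]
  exact fun i j => BS.const _

lemma BM.smul {n : ℕ} {α : Type} [MeasurableSpace α] {P : α → Matrix (Fin n) (Fin n) ℝ}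
    (c : ℝ) (hP : BM P) : BM fun v => c • P v := by
  rw [BM_iff] at *
  exact fun i j => (BS.const c).mul (hP i j)

lemma BM.sum {n : ℕ} {α ι : Type} [MeasurableSpace α] (s : Finset ι)
    {P : ι → α → Matrix (Fin n) (Fin n) ℝ}
    (hP : ∀ k, BM (P k)) : BM fun v => ∑ k ∈ s, P k v := by
  rw [BM_iff]
  intro i j
  simp only [Matrix.sum_apply]
  exact BS.sum _ fun k => (BM_iff.1 (hP k)) i j

lemma BS.qf {n : ℕ} {α : Type} [MeasurableSpace α] {x : α → Fin n → ℝ}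
    {Q : α → Matrix (Fin n) (Fin n) ℝ} (hx : ∀ i, BS fun v => x v i) (hQ : BM Q) :
    BS fun v => qf (x v) (Q v) := by
  unfold SMS.qf
  exact BS.sum _ fun i => BS.sum _ fun j => ((hx i).mul (hx j)).mul (BM_iff.1 hQ i j)

lemma BS.integrable {f : Ω → ℝ} (hf : BS f) (μ : Measure Ω) [IsFiniteMeasure μ] :
    Integrable f μ := by
  obtain ⟨h, C, hC⟩ := hf
  exact Integrable.of_bound h.aestronglyMeasurable C (Filter.Eventually.of_forall hC)

lemma BS.comp {α β : Type} [MeasurableSpace α] [MeasurableSpace β] {f : β → ℝ} (hf : BS f)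
    {g : α → β} (hg : Measurable g) : BS fun a => f (g a) :=
  ⟨hf.1.comp hg, hf.2.imp fun _ h v => h _⟩

lemma BM.comp {n : ℕ} {α β : Type} [MeasurableSpace α] [MeasurableSpace β]
    {Q : β → Matrix (Fin n) (Fin n) ℝ} (hf : BM Q)
    {g : α → β} (hg : Measurable g) : BM fun a => Q (g a) :=
  BM_iff.2 fun i j => (BM_iff.1 hf i j).comp hg

/-- The averaging operator of a kernel. -/
def KQ {n Z : ℕ} (κ : Kernel (Fin Z → ℝ) (Fin Z → ℝ))
    (Q : (Fin Z → ℝ) → Matrix (Fin n) (Fin n) ℝ) (v : Fin Z → ℝ) : Matrix (Fin n) (Fin n) ℝ :=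
  Matrix.of fun i j => ∫ w, Q w i j ∂(κ v)

/-- The Lyapunov operator. -/
def LQ {n Z : ℕ} (κ : Kernel (Fin Z → ℝ) (Fin Z → ℝ))
    (A Q : (Fin Z → ℝ) → Matrix (Fin n) (Fin n) ℝ) (v : Fin Z → ℝ) : Matrix (Fin n) (Fin n) ℝ :=
  (A v)ᵀ * KQ κ Q v * A v

lemma BM.KQ {n Z : ℕ} (κ : Kernel (Fin Z → ℝ) (Fin Z → ℝ)) [IsMarkovKernel κ]
    {Q : (Fin Z → ℝ) → Matrix (Fin n) (Fin n) ℝ} (hQ : BM Q) : BM (KQ κ Q) := by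
  obtain ⟨h, C, hC⟩ := hQ
  refine ⟨fun i j => ?_, C, fun v i j => ?_⟩
  · exact (StronglyMeasurable.integral_kernel (κ := κ) (h i j).stronglyMeasurable).measurable
  · have := norm_integral_le_of_norm_le_const (μ := κ v) (f := fun w => Q w i j) (C := C)
      (Filter.Eventually.of_forall fun w => hC w i j)
    simpa [SMS.KQ] using this

lemma BM.LQ {n Z : ℕ} (κ : Kernel (Fin Z → ℝ) (Fin Z → ℝ)) [IsMarkovKernel κ]
    {A Q : (Fin Z → ℝ) → Matrix (Fin n) (Fin n) ℝ} (hA : BM A) (hQ : BM Q) : BM (LQ κ A Q) :=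
  (hA.transpose.mul (BM.KQ κ hQ)).mul hA

lemma KQ_symm {n Z : ℕ} (κ : Kernel (Fin Z → ℝ) (Fin Z → ℝ))
    {Q : (Fin Z → ℝ) → Matrix (Fin n) (Fin n) ℝ} (hQ : ∀ v, (Q v).IsSymm) (v) :
    (KQ κ Q v).IsSymm := by
  ext i j
  simp only [KQ, Matrix.transpose_apply, Matrix.of_apply]
  congr 1; ext w; exact (hQ w).apply i j

lemma LQ_symm {n Z : ℕ} (κ : Kernel (Fin Z → ℝ) (Fin Z → ℝ))
    {A Q : (Fin Z → ℝ) → Matrix (Fin n) (Fin n) ℝ} (hQ : ∀ v, (Q v).IsSymm) (v) :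
    (LQ κ A Q v).IsSymm := by
  simp only [LQ, Matrix.IsSymm, Matrix.transpose_mul, Matrix.transpose_transpose,
    (KQ_symm κ hQ v).eq, Matrix.mul_assoc]

lemma qf_KQ {n Z : ℕ} (κ : Kernel (Fin Z → ℝ) (Fin Z → ℝ)) [IsMarkovKernel κ]
    {Q : (Fin Z → ℝ) → Matrix (Fin n) (Fin n) ℝ} (hQ : BM Q) (x : Fin n → ℝ) (v) :
    qf x (KQ κ Q v) = ∫ w, qf x (Q w) ∂(κ v) := by
  have hi : ∀ i j, Integrable (fun w => Q w i j) (κ v) := fun i j =>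
    (BM_iff.1 hQ i j).integrable _
  simp only [qf, KQ, Matrix.of_apply]
  rw [integral_finsetSum _ fun i _ => integrable_finsetSum _ fun j _ => (hi i j).const_mul _]
  refine Finset.sum_congr rfl fun i _ => ?_
  rw [integral_finsetSum _ fun j _ => (hi i j).const_mul _]
  refine Finset.sum_congr rfl fun j _ => ?_
  rw [integral_const_mul]

lemma LQ_nonneg {n Z : ℕ} (κ : Kernel (Fin Z → ℝ) (Fin Z → ℝ)) [IsMarkovKernel κ]
    {A Q : (Fin Z → ℝ) → Matrix (Fin n) (Fin n) ℝ} (hQ : BM Q)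
    (h : ∀ v x, 0 ≤ qf x (Q v)) (v x) : 0 ≤ qf x (LQ κ A Q v) := by
  rw [LQ, qf_conj, qf_KQ κ hQ]
  exact integral_nonneg fun w => h w _

lemma KQ_sum {n Z : ℕ} (κ : Kernel (Fin Z → ℝ) (Fin Z → ℝ)) [IsMarkovKernel κ]
    {ι : Type} (s : Finset ι) (c : ι → ℝ)
    {Q : ι → (Fin Z → ℝ) → Matrix (Fin n) (Fin n) ℝ} (hQ : ∀ k, BM (Q k)) (v) :
    KQ κ (fun w => ∑ k ∈ s, c k • Q k w) v = ∑ k ∈ s, c k • KQ κ (Q k) v := by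
  ext i j
  simp only [KQ, Matrix.of_apply, Matrix.sum_apply, Matrix.smul_apply, smul_eq_mul]
  rw [integral_finsetSum _ fun k _ => ((BM_iff.1 (hQ k) i j).integrable _).const_mul _]
  simp only [integral_const_mul]

lemma LQ_sum {n Z : ℕ} (κ : Kernel (Fin Z → ℝ) (Fin Z → ℝ)) [IsMarkovKernel κ]
    {ι : Type} (s : Finset ι) (c : ι → ℝ) (A : (Fin Z → ℝ) → Matrix (Fin n) (Fin n) ℝ)
    {Q : ι → (Fin Z → ℝ) → Matrix (Fin n) (Fin n) ℝ} (hQ : ∀ k, BM (Q k)) (v) :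
    LQ κ A (fun w => ∑ k ∈ s, c k • Q k w) v = ∑ k ∈ s, c k • LQ κ A (Q k) v := by
  simp only [LQ, KQ_sum κ s c hQ, Matrix.mul_sum, Matrix.sum_mul, Matrix.mul_smul,
    Matrix.smul_mul]

/-- The transition kernel. -/
def kap {Z : ℕ} (μ : Measure Ω) [IsFiniteMeasure μ] (ξ : ℤ → Ω → (Fin Z → ℝ)) :
    Kernel (Fin Z → ℝ) (Fin Z → ℝ) := condDistrib (ξ 0) (ξ (-1)) μ

instance {Z : ℕ} (μ : Measure Ω) [IsFiniteMeasure μ] (ξ : ℤ → Ω → (Fin Z → ℝ)) :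
    IsMarkovKernel (kap μ ξ) := by unfold kap; infer_instance

lemma pastSigma_le {Z : ℕ} {ξ : ℤ → Ω → (Fin Z → ℝ)} (hξ : ∀ k, Measurable (ξ k)) (k : ℤ) :
    pastSigma ξ k ≤ (inferInstance : MeasurableSpace Ω) :=
  iSup_le fun t => (hξ t.1).comap_le

lemma pastSigma_mono {Z : ℕ} (ξ : ℤ → Ω → (Fin Z → ℝ)) {k l : ℤ} (h : k ≤ l) :
    pastSigma ξ k ≤ pastSigma ξ l :=
  iSup_le fun t => le_iSup (fun t : {t : ℤ // t ≤ l} =>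
    MeasurableSpace.comap (ξ t.1) inferInstance) ⟨t.1, t.2.trans h⟩

lemma measurable_past {Z : ℕ} (ξ : ℤ → Ω → (Fin Z → ℝ)) {k l : ℤ} (h : k ≤ l) :
    Measurable[pastSigma ξ l] (ξ k) := by
  rw [measurable_iff_comap_le]
  exact le_iSup (fun t : {t : ℤ // t ≤ l} =>
    MeasurableSpace.comap (ξ t.1) inferInstance) ⟨k, h⟩

lemma kap_eq {Z : ℕ} (μ : Measure Ω) [IsFiniteMeasure μ] {ξ : ℤ → Ω → (Fin Z → ℝ)}
    (hξ : ∀ k, Measurable (ξ k)) (h2 : Stationary μ ξ) (t : ℤ) :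
    condDistrib (ξ (t + 1)) (ξ t) μ = kap μ ξ := by
  have h := congrArg (Measure.map fun p : ℤ → Fin Z → ℝ => (p (-1), p 0)) (h2 (t + 1))
  have hg : Measurable fun p : ℤ → Fin Z → ℝ => (p (-1), p 0) := by fun_prop
  rw [Measure.map_map hg (measurable_pi_lambda _ fun k => hξ _),
    Measure.map_map hg (measurable_pi_lambda _ fun k => hξ _)] at h
  have e1 : ((fun p : ℤ → Fin Z → ℝ => (p (-1), p 0)) ∘ fun ω => fun k : ℤ => ξ (k + (t + 1)) ω)
      = fun ω => (ξ t ω, ξ (t + 1) ω) := by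
    funext ω
    simp only [Function.comp]
    rw [show (-1 : ℤ) + (t + 1) = t by ring, show (0 : ℤ) + (t + 1) = t + 1 by ring]
  rw [e1] at h
  rw [kap, condDistrib, condDistrib]
  congr 1

lemma ae_transport {Z : ℕ} (μ : Measure Ω) {ξ : ℤ → Ω → (Fin Z → ℝ)}
    (hξ : ∀ k, Measurable (ξ k)) (h2 : Stationary μ ξ) (s t : ℤ) {p : (Fin Z → ℝ) → Prop}
    (hp : MeasurableSet {v | p v}) (h : ∀ᵐ ω ∂μ, p (ξ s ω)) : ∀ᵐ ω ∂μ, p (ξ t ω) := by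
  have key := congrArg (Measure.map fun q : ℤ → Fin Z → ℝ => q s) (h2 (t - s))
  have hg : Measurable fun q : ℤ → Fin Z → ℝ => q s := by fun_prop
  rw [Measure.map_map hg (measurable_pi_lambda _ fun k => hξ _),
    Measure.map_map hg (measurable_pi_lambda _ fun k => hξ _)] at key
  have e1 : ((fun q : ℤ → Fin Z → ℝ => q s) ∘ fun ω => fun k : ℤ => ξ (k + (t - s)) ω)
      = ξ t := by
    funext ω
    simp only [Function.comp]
    rw [show s + (t - s) = t by ring]
  have e2 : ((fun q : ℤ → Fin Z → ℝ => q s) ∘ fun ω => fun k : ℤ => ξ k ω) = ξ s := rfl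
  rw [e1, e2] at key
  have := (ae_map_iff (hξ s).aemeasurable hp).2 h
  rw [← key] at this
  exact (ae_map_iff (hξ t).aemeasurable hp).1 this

lemma scalar_sigma {Z : ℕ} (μ : Measure Ω) [IsFiniteMeasure μ] {ξ : ℤ → Ω → (Fin Z → ℝ)}
    (hξ : ∀ k, Measurable (ξ k)) (h2 : Stationary μ ξ) (t : ℤ)
    {f : (Fin Z → ℝ) → ℝ} (hf : BS f) :
    μ[(fun ω => f (ξ (t + 1) ω)) | sigmaOf (ξ t)] =ᵐ[μ]
      fun ω => ∫ w, f w ∂(kap μ ξ (ξ t ω)) := by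
  rw [← kap_eq μ hξ h2 t]
  exact condExp_ae_eq_integral_condDistrib (hξ t) (hξ (t + 1)).aemeasurable
    hf.1.stronglyMeasurable ((hf.comp (hξ _)).integrable μ)

lemma scalar_past {Z : ℕ} (μ : Measure Ω) [IsFiniteMeasure μ] {ξ : ℤ → Ω → (Fin Z → ℝ)}
    (hξ : ∀ k, Measurable (ξ k)) (h2 : Stationary μ ξ) (hm : MarkovProp μ ξ) (t : ℤ)
    {f : (Fin Z → ℝ) → ℝ} (hf : BS f) :
    μ[(fun ω => f (ξ (t + 1) ω)) | pastSigma ξ t] =ᵐ[μ]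
      fun ω => ∫ w, f w ∂(kap μ ξ (ξ t ω)) :=
  (hm t (t + 1) (by omega) f hf.1 hf.2).trans (scalar_sigma μ hξ h2 t hf)

lemma qf_past {n Z : ℕ} (μ : Measure Ω) [IsFiniteMeasure μ] {ξ : ℤ → Ω → (Fin Z → ℝ)}
    (hξ : ∀ k, Measurable (ξ k)) (h2 : Stationary μ ξ) (hm : MarkovProp μ ξ) (t : ℤ)
    {Q : (Fin Z → ℝ) → Matrix (Fin n) (Fin n) ℝ} (hQ : BM Q) (x : Ω → Fin n → ℝ)
    (hx : ∀ i, Measurable[pastSigma ξ t] fun ω => x ω i) (hb : ∀ i, BS fun ω => x ω i) :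
    μ[(fun ω => qf (x ω) (Q (ξ (t + 1) ω))) | pastSigma ξ t] =ᵐ[μ]
      fun ω => qf (x ω) (KQ (kap μ ξ) Q (ξ t ω)) := by
  have hQ' := BM_iff.1 hQ
  have hint : ∀ i j, Integrable (fun ω => x ω i * x ω j * Q (ξ (t + 1) ω) i j) μ := fun i j =>
    (((hb i).mul (hb j)).mul ((hQ' i j).comp (hξ _))).integrable μ
  have e : (fun ω => qf (x ω) (Q (ξ (t + 1) ω)))
      = ∑ p : Fin n × Fin n, fun ω => x ω p.1 * x ω p.2 * Q (ξ (t + 1) ω) p.1 p.2 := by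
    funext ω
    simp [qf, Fintype.sum_prod_type]
  rw [e]
  have h1 := condExp_finsetSum (μ := μ) (s := (Finset.univ : Finset (Fin n × Fin n)))
    (f := fun p ω => x ω p.1 * x ω p.2 * Q (ξ (t + 1) ω) p.1 p.2)
    (fun p _ => hint p.1 p.2) (pastSigma ξ t)
  refine h1.trans ?_
  have h2' : ∀ p : Fin n × Fin n,
      μ[(fun ω => x ω p.1 * x ω p.2 * Q (ξ (t + 1) ω) p.1 p.2) | pastSigma ξ t] =ᵐ[μ]
      fun ω => x ω p.1 * x ω p.2 * ∫ w, Q w p.1 p.2 ∂(kap μ ξ (ξ t ω)) := by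
    intro p
    have a1 := condExp_mul_of_stronglyMeasurable_left (μ := μ) (m := pastSigma ξ t)
      (f := fun ω => x ω p.1 * x ω p.2) (g := fun ω => Q (ξ (t + 1) ω) p.1 p.2)
      ((hx p.1).mul (hx p.2)).stronglyMeasurable (hint p.1 p.2)
      (((hQ' p.1 p.2).comp (hξ _)).integrable μ)
    have a2 := scalar_past μ hξ h2 hm t (hQ' p.1 p.2)
    refine a1.trans ?_
    filter_upwards [a2] with ω hω
    simp only [Pi.mul_apply, hω]
  have h3 : ∀ᵐ ω ∂μ, ∀ p : Fin n × Fin n, 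
      (μ[(fun ω => x ω p.1 * x ω p.2 * Q (ξ (t + 1) ω) p.1 p.2) | pastSigma ξ t]) ω =
      x ω p.1 * x ω p.2 * ∫ w, Q w p.1 p.2 ∂(kap μ ξ (ξ t ω)) := ae_all_iff.2 h2'
  filter_upwards [h3] with ω hω
  simp only [Finset.sum_apply, hω, qf, KQ, Matrix.of_apply, Fintype.sum_prod_type]

lemma state_meas {n Z : ℕ} {A : (Fin Z → ℝ) → Matrix (Fin n) (Fin n) ℝ} (hA : BM A)
    (ξ : ℤ → Ω → (Fin Z → ℝ)) (k : ℤ) (y : Fin n → ℝ) (m : ℕ) (l : ℤ) (hl : k + m ≤ l + 1) 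
    (i : Fin n) :
    Measurable[pastSigma ξ l] fun ω => state A ξ k y m ω i := by
  induction m generalizing i with
  | zero => exact @measurable_const _ _ _ (pastSigma ξ l) _
  | succ m ih =>
    simp only [state, mulVec, dotProduct]
    refine @Finset.measurable_sum _ _ _ _ _ _ (pastSigma ξ l) _ _ fun j _ => ?_
    refine Measurable.mul ?_ (ih (by push_cast at hl; omega) j)
    exact (hA.1 i j).comp (measurable_past ξ (by push_cast at hl; omega))

lemma state_bdd {n Z : ℕ} {A : (Fin Z → ℝ) → Matrix (Fin n) (Fin n) ℝ} (hA : BM A)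
    {ξ : ℤ → Ω → (Fin Z → ℝ)} (hξ : ∀ k, Measurable (ξ k)) (k : ℤ) (y : Fin n → ℝ) (m : ℕ)
    (i : Fin n) : BS fun ω => state A ξ k y m ω i := by
  induction m generalizing i with
  | zero => exact BS.const _
  | succ m ih =>
    simp only [state, mulVec, dotProduct]
    exact BS.sum _ fun j => ((BM_iff.1 hA i j).comp (hξ _)).mul (ih j)

/-- First step. -/
lemma step_zero {n Z : ℕ} (μ : Measure Ω) [IsFiniteMeasure μ] {ξ : ℤ → Ω → (Fin Z → ℝ)}
    (hξ : ∀ k, Measurable (ξ k)) (h2 : Stationary μ ξ) (hm : MarkovProp μ ξ) 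
    {Q : (Fin Z → ℝ) → Matrix (Fin n) (Fin n) ℝ} (hQ : BM Q) (k : ℤ) (y : Fin n → ℝ) :
    μ[(fun ω => qf y (Q (ξ k ω))) | pastSigma ξ (k - 1)] =ᵐ[μ]
      fun ω => qf y (KQ (kap μ ξ) Q (ξ (k - 1) ω)) := by
  have := qf_past μ hξ h2 hm (k - 1) hQ (fun _ => y)
    (fun i => @measurable_const _ _ _ (pastSigma ξ (k - 1)) _) (fun i => BS.const _)
  simpa using this

/-- One step. -/
lemma step_succ {n Z : ℕ} (μ : Measure Ω) [IsFiniteMeasure μ] {ξ : ℤ → Ω → (Fin Z → ℝ)}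
    (hξ : ∀ k, Measurable (ξ k)) (h2 : Stationary μ ξ) (hm : MarkovProp μ ξ) 
    {A Q : (Fin Z → ℝ) → Matrix (Fin n) (Fin n) ℝ} (hA : BM A) (hQ : BM Q) (k : ℤ)
    (y : Fin n → ℝ) (m : ℕ) :
    μ[(fun ω => qf (state A ξ k y (m + 1) ω) (Q (ξ (k + (m + 1 : ℕ)) ω))) | pastSigma ξ (k + m)]
      =ᵐ[μ] fun ω => qf (state A ξ k y m ω) (LQ (kap μ ξ) A Q (ξ (k + m) ω)) := by
  have := qf_past μ hξ h2 hm (k + m) hQ (state A ξ k y (m + 1))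
    (fun i => state_meas hA ξ k y (m + 1) (k + m) (by push_cast; omega) i)
    (fun i => state_bdd hA hξ k y (m + 1) i)
  rw [show k + (m + 1 : ℕ) = k + m + 1 by push_cast; ring]
  refine this.trans (Filter.Eventually.of_forall fun ω => ?_)
  simp only [LQ, qf_conj]
  rfl

lemma W_int {n Z : ℕ} (μ : Measure Ω) [IsFiniteMeasure μ] {ξ : ℤ → Ω → (Fin Z → ℝ)}
    (hξ : ∀ k, Measurable (ξ k))
    {A Q : (Fin Z → ℝ) → Matrix (Fin n) (Fin n) ℝ} (hA : BM A) (hQ : BM Q) (k l : ℤ)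
    (y : Fin n → ℝ) (m : ℕ) : Integrable (fun ω => qf (state A ξ k y m ω) (Q (ξ l ω))) μ :=
  (BS.qf (fun i => state_bdd hA hξ k y m i) (hQ.comp (hξ l))).integrable μ

/-- Iterates of the Lyapunov operator. -/
def LI {n Z : ℕ} (κ : Kernel (Fin Z → ℝ) (Fin Z → ℝ))
    (A : (Fin Z → ℝ) → Matrix (Fin n) (Fin n) ℝ) :
    ℕ → (Fin Z → ℝ) → Matrix (Fin n) (Fin n) ℝ
  | 0 => fun _ => 1
  | m + 1 => LQ κ A (LI κ A m)

lemma LI_BM {n Z : ℕ} (κ : Kernel (Fin Z → ℝ) (Fin Z → ℝ)) [IsMarkovKernel κ]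
    {A : (Fin Z → ℝ) → Matrix (Fin n) (Fin n) ℝ} (hA : BM A) (m : ℕ) : BM (LI κ A m) := by
  induction m with
  | zero => exact BM.const _
  | succ m ih => exact BM.LQ κ hA ih

lemma LI_symm {n Z : ℕ} (κ : Kernel (Fin Z → ℝ) (Fin Z → ℝ))
    (A : (Fin Z → ℝ) → Matrix (Fin n) (Fin n) ℝ) (m : ℕ) (v) : (LI κ A m v).IsSymm := by
  induction m generalizing v with
  | zero => exact Matrix.isSymm_one
  | succ m ih => exact LQ_symm κ ih v

lemma LI_nonneg {n Z : ℕ} (κ : Kernel (Fin Z → ℝ) (Fin Z → ℝ)) [IsMarkovKernel κ]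
    {A : (Fin Z → ℝ) → Matrix (Fin n) (Fin n) ℝ} (hA : BM A) (m : ℕ) (v x) :
    0 ≤ qf x (LI κ A m v) := by
  induction m generalizing v x with
  | zero => simp only [LI, qf_one]; exact sqNorm_nonneg x
  | succ m ih => exact LQ_nonneg κ (LI_BM κ hA m) ih v x

lemma smom_gen {n Z : ℕ} (μ : Measure Ω) [IsFiniteMeasure μ] {ξ : ℤ → Ω → (Fin Z → ℝ)}
    (hξ : ∀ k, Measurable (ξ k)) (h2 : Stationary μ ξ) (hm : MarkovProp μ ξ) 
    {A : (Fin Z → ℝ) → Matrix (Fin n) (Fin n) ℝ} (hA : BM A) (k : ℤ)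
    (y : Fin n → ℝ) (m : ℕ) (p : ℕ) :
    μ[(fun ω => qf (state A ξ k y m ω) (LI (kap μ ξ) A p (ξ (k + m) ω))) | pastSigma ξ (k - 1)]
      =ᵐ[μ] fun ω => qf y (KQ (kap μ ξ) (LI (kap μ ξ) A (p + m)) (ξ (k - 1) ω)) := by
  induction m generalizing p with
  | zero => simpa [state] using step_zero μ hξ h2 hm (LI_BM (kap μ ξ) hA p) k y
  | succ m ih =>
    have h1 := step_succ μ hξ h2 hm hA (LI_BM (kap μ ξ) hA p) k y m
    have h2' := condExp_condExp_of_le (μ := μ)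
      (f := fun ω => qf (state A ξ k y (m + 1) ω) (LI (kap μ ξ) A p (ξ (k + (m + 1 : ℕ)) ω)))
      (pastSigma_mono ξ (show k - 1 ≤ k + m by omega)) (pastSigma_le hξ (k + m))
    have h3 := condExp_congr_ae (m := pastSigma ξ (k - 1)) h1
    refine h2'.symm.trans (h3.trans ?_)
    have := ih (p + 1)
    rw [show p + 1 + m = p + (m + 1) by ring] at this
    exact this

lemma smom_eq {n Z : ℕ} (μ : Measure Ω) [IsFiniteMeasure μ] {ξ : ℤ → Ω → (Fin Z → ℝ)}
    (hξ : ∀ k, Measurable (ξ k)) (h2 : Stationary μ ξ) (hm : MarkovProp μ ξ) 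
    {A : (Fin Z → ℝ) → Matrix (Fin n) (Fin n) ℝ} (hA : BM A) (k : ℤ)
    (y : Fin n → ℝ) (m : ℕ) :
    smom μ A ξ k y m
      =ᵐ[μ] fun ω => qf y (KQ (kap μ ξ) (LI (kap μ ξ) A m) (ξ (k - 1) ω)) := by
  have := smom_gen μ hξ h2 hm hA k y m 0
  simp only [LI, qf_one, zero_add] at this
  exact this

/-- Core of the backward direction. -/
lemma core_backward {n Z : ℕ} (μ : Measure Ω) [IsFiniteMeasure μ] {ξ : ℤ → Ω → (Fin Z → ℝ)}
    (hξ : ∀ k, Measurable (ξ k)) (h2 : Stationary μ ξ) (hm : MarkovProp μ ξ) 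
    {A R : (Fin Z → ℝ) → Matrix (Fin n) (Fin n) ℝ} (hA : BM A) (hR : BM R)
    {el eu lam : ℝ} (hel : 0 < el) (heu : 0 < eu)
    (hl : ∀ t, ∀ᵐ ω ∂μ, ∀ x, el * sqNorm x ≤ qf x (R (ξ t ω)))
    (hu : ∀ t, ∀ᵐ ω ∂μ, ∀ x, qf x (R (ξ t ω)) ≤ eu * sqNorm x)
    (hL : ∀ t, ∀ᵐ ω ∂μ, ∀ x, qf x (LQ (kap μ ξ) A R (ξ t ω)) ≤ lam ^ 2 * qf x (R (ξ t ω))) :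
    ExpStableWith μ A ξ lam := by
  refine ⟨eu / el, by positivity, fun k y m => ?_⟩
  have hW := fun m => W_int μ hξ hA hR k (k + (m : ℕ)) y m
  have key : ∀ m : ℕ, ∀ᵐ ω ∂μ,
      (μ[(fun ω => qf (state A ξ k y m ω) (R (ξ (k + m) ω))) | pastSigma ξ (k - 1)]) ω
        ≤ eu * sqNorm y * lam ^ (2 * m) := by
    intro m
    induction m with
    | zero =>
      have h := condExp_mono (m := pastSigma ξ (k - 1)) (hW 0)
        (integrable_const (μ := μ) (eu * sqNorm y)) (by
          filter_upwards [hu (k + (0 : ℕ))] with ω hω using hω y)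
      rw [condExp_const (pastSigma_le hξ (k - 1))] at h
      filter_upwards [h] with ω hω
      simpa using hω
    | succ m ih =>
      have h1 := step_succ μ hξ h2 hm hA hR k y m
      have h2' := condExp_condExp_of_le (μ := μ)
        (f := fun ω => qf (state A ξ k y (m + 1) ω) (R (ξ (k + (m + 1 : ℕ)) ω)))
        (pastSigma_mono ξ (show k - 1 ≤ k + m by omega)) (pastSigma_le hξ (k + m))
      have h3 := condExp_congr_ae (m := pastSigma ξ (k - 1)) h1
      have h4 := condExp_mono (m := pastSigma ξ (k - 1))
        (W_int μ hξ hA (BM.LQ (kap μ ξ) hA hR) k (k + m) y m) ((hW m).const_mul (lam ^ 2)) (by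
          filter_upwards [hL (k + m)] with ω hω using hω _)
      have h5 := condExp_smul (μ := μ) (lam ^ 2)
        (fun ω => qf (state A ξ k y m ω) (R (ξ (k + m) ω))) (pastSigma ξ (k - 1))
      have h6 : ((lam ^ 2) • (fun ω => qf (state A ξ k y m ω) (R (ξ (k + m) ω))))
        = fun ω => lam ^ 2 * qf (state A ξ k y m ω) (R (ξ (k + m) ω)) := rfl
      rw [h6] at h5
      filter_upwards [h2', h3, h4, h5, ih] with ω a2 a3 a4 a5 a6
      rw [← a2, a3]
      refine a4.trans ?_
      rw [a5]
      calc lam ^ 2 * _ ≤ lam ^ 2 * (eu * sqNorm y * lam ^ (2 * m)) :=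
            mul_le_mul_of_nonneg_left a6 (sq_nonneg _)
        _ = _ := by ring
  have hI : Integrable (fun ω => sqNorm (state A ξ k y m ω)) μ := by
    have := W_int μ hξ hA (BM.const (1 : Matrix (Fin n) (Fin n) ℝ)) k k y m
    simpa only [qf_one] using this
  have h4 := condExp_mono (m := pastSigma ξ (k - 1)) (hI.const_mul el) (hW m) (by
    filter_upwards [hl (k + m)] with ω hω using hω _)
  have h5 := condExp_smul (μ := μ) el (fun ω => sqNorm (state A ξ k y m ω)) (pastSigma ξ (k - 1))
  have h6 : (el • (fun ω => sqNorm (state A ξ k y m ω)))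
        = fun ω => el * sqNorm (state A ξ k y m ω) := rfl
  rw [h6] at h5
  filter_upwards [h4, h5, key m] with ω a4 a5 a6
  rw [a5] at a4
  have a7 : el * smom μ A ξ k y m ω ≤ eu * sqNorm y * lam ^ (2 * m) := a4.trans a6
  have : eu / el * sqNorm y * lam ^ (2 * m) = (eu * sqNorm y * lam ^ (2 * m)) / el := by
    field_simp
  rw [this, le_div_iff₀ hel]
  linarith

/-- Truncation. -/
def trunc {n : ℕ} {α : Type} (C : ℝ) (Q : α → Matrix (Fin n) (Fin n) ℝ) (v : α) :
    Matrix (Fin n) (Fin n) ℝ :=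
  open Classical in if ∀ i j, |Q v i j| ≤ C then Q v else 0

lemma measurableSet_bd {n : ℕ} {α : Type} [MeasurableSpace α] (C : ℝ)
    {Q : α → Matrix (Fin n) (Fin n) ℝ} (hQ : ∀ i j, Measurable fun v => Q v i j) :
    MeasurableSet {v | ∀ i j, |Q v i j| ≤ C} := by
  simp only [Set.ofPred_forall]
  refine MeasurableSet.iInter fun i => MeasurableSet.iInter fun j => ?_
  exact measurableSet_le ((hQ i j).abs) measurable_const

lemma trunc_BM {n : ℕ} {α : Type} [MeasurableSpace α] {C : ℝ} (hC : 0 ≤ C)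
    {Q : α → Matrix (Fin n) (Fin n) ℝ} (hQ : ∀ i j, Measurable fun v => Q v i j) :
    BM (trunc C Q) := by
  classical
  refine ⟨fun i j => ?_, C, fun v i j => ?_⟩
  · have : (fun v => trunc C Q v i j) = fun v => if ∀ i j, |Q v i j| ≤ C then Q v i j else 0 := by
      funext v; unfold trunc; split_ifs <;> rfl
    rw [this]
    exact Measurable.ite (measurableSet_bd C hQ) (hQ i j) measurable_const
  · unfold trunc; split_ifs with h
    · exact h i j
    · simpa using hC

lemma trunc_eq {n : ℕ} {α : Type} {C : ℝ} {Q : α → Matrix (Fin n) (Fin n) ℝ} {v : α}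
    (h : ∀ i j, |Q v i j| ≤ C) : trunc C Q v = Q v := by
  unfold trunc; rw [if_pos h]

lemma state_congr {n Z : ℕ} {A B : (Fin Z → ℝ) → Matrix (Fin n) (Fin n) ℝ}
    {ξ : ℤ → Ω → (Fin Z → ℝ)} {ω : Ω} (h : ∀ k, A (ξ k ω) = B (ξ k ω)) (k y m) :
    state A ξ k y m ω = state B ξ k y m ω := by
  induction m with
  | zero => rfl
  | succ m ih => simp only [state, ih, h]

lemma expStable_congr {n Z : ℕ} (μ : Measure Ω) {A B : (Fin Z → ℝ) → Matrix (Fin n) (Fin n) ℝ}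
    {ξ : ℤ → Ω → (Fin Z → ℝ)} (h : ∀ᵐ ω ∂μ, ∀ k, A (ξ k ω) = B (ξ k ω))
    (hs : ExpStable μ A ξ) : ExpStable μ B ξ := by
  obtain ⟨lam, h0, h1, a, ha, H⟩ := hs
  refine ⟨lam, h0, h1, a, ha, fun k y m => ?_⟩
  have : smom μ A ξ k y m =ᵐ[μ] smom μ B ξ k y m := by
    apply condExp_congr_ae
    filter_upwards [h] with ω hω
    rw [state_congr hω]
  filter_upwards [this, H k y m] with ω e1 e2
  rwa [← e1]

lemma condExpM_eq {n Z : ℕ} (μ : Measure Ω) [IsFiniteMeasure μ] {ξ : ℤ → Ω → (Fin Z → ℝ)}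
    (hξ : ∀ k, Measurable (ξ k)) (h2 : Stationary μ ξ)
    {R R' : (Fin Z → ℝ) → Matrix (Fin n) (Fin n) ℝ} (hR : BM R)
    (he : ∀ᵐ ω ∂μ, R' (ξ 0 ω) = R (ξ 0 ω)) :
    ∀ᵐ ω ∂μ, condExpM μ (sigmaOf (ξ (-1))) (fun ω' => R' (ξ 0 ω')) ω
      = KQ (kap μ ξ) R (ξ (-1) ω) := by
  have h : ∀ i j, ∀ᵐ ω ∂μ, condExpM μ (sigmaOf (ξ (-1))) (fun ω' => R' (ξ 0 ω')) ω i j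
      = KQ (kap μ ξ) R (ξ (-1) ω) i j := by
    intro i j
    have h1 := scalar_sigma μ hξ h2 (-1) (BM_iff.1 hR i j)
    have h3 : (fun ω => R' (ξ 0 ω) i j) =ᵐ[μ] fun ω => R (ξ (-1 + 1) ω) i j := by
      filter_upwards [he] with ω hω
      rw [hω]; norm_num
    exact (condExp_congr_ae h3).trans h1
  have := ae_all_iff.2 fun i => ae_all_iff.2 fun j => h i j
  filter_upwards [this] with ω hω
  ext i j; exact hω i j

lemma qf_le {n : ℕ} {M : Matrix (Fin n) (Fin n) ℝ} {C : ℝ} (h : ∀ i j, |M i j| ≤ C)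
    (x : Fin n → ℝ) : qf x M ≤ C * n * sqNorm x := by
  have h1 : ∀ i j, x i * x j * M i j ≤ C / 2 * (x i ^ 2 + x j ^ 2) := by
    intro i j
    have a1 : x i * x j * M i j ≤ |x i| * |x j| * |M i j| := by
      rw [← abs_mul, ← abs_mul]; exact le_abs_self _
    have a2 : |x i| * |x j| * |M i j| ≤ |x i| * |x j| * C :=
      mul_le_mul_of_nonneg_left (h i j) (by positivity)
    have hC : 0 ≤ C := (abs_nonneg _).trans (h i j)
    have a3 : |x i| * |x j| ≤ (x i ^ 2 + x j ^ 2) / 2 := by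
      rw [← sq_abs (x i), ← sq_abs (x j)]; nlinarith [sq_nonneg (|x i| - |x j|)]
    nlinarith
  calc qf x M ≤ ∑ i, ∑ j, C / 2 * (x i ^ 2 + x j ^ 2) :=
        Finset.sum_le_sum fun i _ => Finset.sum_le_sum fun j _ => h1 i j
    _ = C * n * sqNorm x := by
        simp only [← Finset.mul_sum, Finset.sum_add_distrib, sqNorm, Finset.sum_const,
          Finset.card_univ, Fintype.card_fin, nsmul_eq_mul]
        ring

/-- Core of the forward direction. -/
lemma core_forward {n Z : ℕ} (μ : Measure Ω) [IsFiniteMeasure μ] {ξ : ℤ → Ω → (Fin Z → ℝ)}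
    (hξ : ∀ k, Measurable (ξ k)) (h2 : Stationary μ ξ) (hm : MarkovProp μ ξ) 
    {A : (Fin Z → ℝ) → Matrix (Fin n) (Fin n) ℝ} (hA : BM A) (hs : ExpStable μ A ξ) :
    ∃ el eu ep lam : ℝ, 0 < el ∧ 0 < eu ∧ 0 < ep ∧ 0 < lam ∧ lam < 1 ∧
        ∃ R : (Fin Z → ℝ) → Matrix (Fin n) (Fin n) ℝ,
          BM R ∧ (∀ v, (R v).IsSymm) ∧ (∀ v x, el * sqNorm x ≤ qf x (R v)) ∧
          (∀ v x, qf x (R v) ≤ eu * sqNorm x) ∧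
          (∀ᵐ ω ∂μ, ∀ x, qf x (LQ (kap μ ξ) A R (ξ (-1) ω)) + ep * sqNorm x
            ≤ lam ^ 2 * qf x (R (ξ (-1) ω))) := by
  obtain ⟨lam, h0, h1, a, ha, H⟩ := hs
  set κ := kap μ ξ with hκ
  obtain ⟨-, D0, hD0⟩ := hA.transpose.mul hA
  set D := |D0| * n with hD
  have hDnn : 0 ≤ D := by positivity
  have hAx : ∀ v x, sqNorm (A v *ᵥ x) ≤ D * sqNorm x := by
    intro v x
    rw [← qf_one, ← qf_conj, Matrix.mul_one]
    exact qf_le (fun i j => (hD0 v i j).trans (le_abs_self _)) x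
  obtain ⟨N, hN⟩ := exists_pow_lt_of_lt_one (show 0 < lam / (2 * (a * D + 1)) by positivity) h1
  have hN' : a * D * lam ^ N ≤ lam / 2 := by
    rw [lt_div_iff₀ (by positivity)] at hN
    have : 0 < lam ^ N := by positivity
    nlinarith
  have hbd : ∀ᵐ ω ∂μ, ∀ x, qf x (LI κ A (N + 1) (ξ (-1) ω)) ≤ a * lam ^ (2 * N) * D * sqNorm x := by
    have e1 : ∀ᵐ ω ∂μ, ∀ x, 0 ≤ qf x ((a * lam ^ (2 * N)) • (1 : Matrix (Fin n) (Fin n) ℝ)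
        - KQ κ (LI κ A N) (ξ (-1) ω)) := by
      refine ae_all_qf μ _ fun x => ?_
      have b1 := smom_eq μ hξ h2 hm hA 0 x N
      have b2 := H 0 x N
      filter_upwards [b1, b2] with ω c1 c2
      rw [c1] at c2
      rw [qf_sub, qf_smul, qf_one]
      norm_num at c2
      linarith
    filter_upwards [e1] with ω hω x
    have := hω (A (ξ (-1) ω) *ᵥ x)
    rw [qf_sub, qf_smul, qf_one] at this
    simp only [LI, LQ, qf_conj]
    have h3 := mul_le_mul_of_nonneg_left (hAx (ξ (-1) ω) x)
      (show 0 ≤ a * lam ^ (2 * N) by positivity)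
    linarith
  set R : (Fin Z → ℝ) → Matrix (Fin n) (Fin n) ℝ :=
    fun v => ∑ m ∈ Finset.range (N + 1), (lam⁻¹) ^ m • LI κ A m v with hR
  have hRB : BM R := BM.sum _ fun m => (LI_BM κ hA m).smul _
  have hRL : ∀ v x, qf x (LQ κ A R v) = lam * (qf x (R v)
      + (lam⁻¹) ^ (N + 1) * qf x (LI κ A (N + 1) v) - sqNorm x) := by
    intro v x
    have e1 : LQ κ A R v = ∑ m ∈ Finset.range (N + 1), (lam⁻¹) ^ m • LI κ A (m + 1) v :=
      LQ_sum κ _ _ A (fun m => LI_BM κ hA m) v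
    have e2 : qf x (R v) + (lam⁻¹) ^ (N + 1) * qf x (LI κ A (N + 1) v)
        = ∑ m ∈ Finset.range (N + 1 + 1), (lam⁻¹) ^ m * qf x (LI κ A m v) := by
      rw [Finset.sum_range_succ _ (N + 1)]
      simp only [hR, qf_sum, qf_smul]
    have e3 : qf x (LI κ A 0 v) = sqNorm x := by simp only [LI, qf_one]
    rw [e2, Finset.sum_range_succ', e1, e3]
    simp only [qf_sum, qf_smul, pow_zero, one_mul, add_sub_cancel_right, Finset.mul_sum]
    refine Finset.sum_congr rfl fun m _ => ?_
    rw [pow_succ]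
    field_simp
  obtain ⟨-, C, hC⟩ := id hRB
  have hsq : Real.sqrt lam ^ 2 = lam := Real.sq_sqrt h0.le
  refine ⟨1, |C| * n + 1, lam / 2, Real.sqrt lam, one_pos, by positivity, by positivity,
    Real.sqrt_pos.2 h0, ?_, R, hRB, ?_, ?_, ?_, ?_⟩
  · rw [Real.sqrt_lt' one_pos]; simpa using h1
  · intro v
    simp only [hR, Matrix.IsSymm, Matrix.transpose_sum, Matrix.transpose_smul,
      (LI_symm κ A _ v).eq]
  · intro v x
    simp only [hR, qf_sum, qf_smul]
    have := Finset.single_le_sum (s := Finset.range (N + 1))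
      (f := fun m => (lam⁻¹) ^ m * qf x (LI κ A m v))
      (fun m _ => mul_nonneg (by positivity) (LI_nonneg κ hA m v x))
      (Finset.mem_range.2 (Nat.succ_pos N))
    simpa [LI, qf_one] using this
  · intro v x
    have := qf_le (fun i j => (hC v i j).trans (le_abs_self _)) x
    have := sqNorm_nonneg x
    linarith
  · filter_upwards [hbd] with ω hω x
    rw [hRL, hsq]
    have e1 : (lam⁻¹) ^ (N + 1) * qf x (LI κ A (N + 1) (ξ (-1) ω)) ≤ 1 / 2 * sqNorm x := by
      calc _ ≤ (lam⁻¹) ^ (N + 1) * (a * lam ^ (2 * N) * D * sqNorm x) :=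
            mul_le_mul_of_nonneg_left (hω x) (by positivity)
        _ = lam⁻¹ * (a * D * lam ^ N) * sqNorm x := by
            rw [inv_pow]; field_simp; ring
        _ ≤ lam⁻¹ * (lam / 2) * sqNorm x := by
            have := sqNorm_nonneg x
            gcongr
        _ = _ := by field_simp
    nlinarith

theorem markov_expStable_iff_lyapR {n Z : ℕ} (hn : 0 < n) (hZ : 0 < Z) {Ω : Type} [MeasurableSpace Ω]
    (μ : Measure Ω) [IsProbabilityMeasure μ]
    (A : (Fin Z → ℝ) → Matrix (Fin n) (Fin n) ℝ)
    (hA : ∀ i j : Fin n, Measurable fun v => A v i j)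
    (ξ : ℤ → Ω → (Fin Z → ℝ)) (hξ : ∀ k : ℤ, Measurable (ξ k))
    (h2 : Stationary μ ξ) (h3 : Assumption3 μ A ξ) (hm : MarkovProp μ ξ) :
    ExpStable μ A ξ ↔
      ∃ el eu ep lam : ℝ, 0 < el ∧ 0 < eu ∧ 0 < ep ∧ 0 < lam ∧ lam < 1 ∧
        ∃ R₀ : (Fin Z → ℝ) → Matrix (Fin n) (Fin n) ℝ,
          (∀ i j : Fin n, Measurable fun v => R₀ v i j) ∧ (∀ v, (R₀ v).IsSymm) ∧
          (∀ᵐ ω ∂μ, (R₀ (ξ (-1) ω) - el • (1 : Matrix (Fin n) (Fin n) ℝ)).PosSemidef) ∧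
          (∀ᵐ ω ∂μ, (eu • (1 : Matrix (Fin n) (Fin n) ℝ) - R₀ (ξ (-1) ω)).PosSemidef) ∧
          (∀ᵐ ω ∂μ, (lam ^ 2 • R₀ (ξ (-1) ω)
              - (A (ξ (-1) ω))ᵀ
                * condExpM μ (sigmaOf (ξ (-1))) (fun ω' => R₀ (ξ 0 ω')) ω
                * A (ξ (-1) ω)
              - ep • (1 : Matrix (Fin n) (Fin n) ℝ)).PosSemidef) := by
  obtain ⟨M, hM, hM3⟩ := h3
  set B := trunc M A with hBdef
  have hB : BM B := trunc_BM hM.le hA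
  have hAB : ∀ᵐ ω ∂μ, ∀ k, B (ξ k ω) = A (ξ k ω) := by
    have : ∀ᵐ ω ∂μ, ∀ k : ℤ, ∀ i j : Fin n, |A (ξ k ω) i j| < M :=
      ae_all_iff.2 fun k => ae_all_iff.2 fun i => ae_all_iff.2 fun j => hM3 k i j
    filter_upwards [this] with ω hω k
    exact trunc_eq fun i j => (hω k i j).le
  constructor
  · intro hs
    have hs' : ExpStable μ B ξ := expStable_congr μ (by
      filter_upwards [hAB] with ω hω k using (hω k).symm) hs
    obtain ⟨el, eu, ep, lam, p1, p2, p3, p4, p5, R, hR, hRs, hl, hu, hL⟩ :=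
      core_forward μ hξ h2 hm hB hs'
    refine ⟨el, eu, ep, lam, p1, p2, p3, p4, p5, R, hR.1, hRs, ?_, ?_, ?_⟩
    · refine Filter.Eventually.of_forall fun ω => ?_
      rw [psd_iff _ ((hRs _).sub (Matrix.isSymm_one.smul _))]
      intro x
      rw [qf_sub, qf_smul, qf_one]
      linarith [hl (ξ (-1) ω) x]
    · refine Filter.Eventually.of_forall fun ω => ?_
      rw [psd_iff _ ((Matrix.isSymm_one.smul _).sub (hRs _))]
      intro x
      rw [qf_sub, qf_smul, qf_one]
      linarith [hu (ξ (-1) ω) x]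
    · filter_upwards [hL, hAB, condExpM_eq μ hξ h2 hR (Filter.Eventually.of_forall fun _ => rfl)]
        with ω h1 h4 h5
      rw [h5, ← h4 (-1)]
      change (lam ^ 2 • R (ξ (-1) ω) - LQ (kap μ ξ) B R (ξ (-1) ω)
        - ep • (1 : Matrix (Fin n) (Fin n) ℝ)).PosSemidef
      rw [psd_iff _ ((((hRs _).smul _).sub (LQ_symm _ hRs _)).sub (Matrix.isSymm_one.smul _))]
      intro x
      rw [qf_sub, qf_sub, qf_smul, qf_smul, qf_one]
      linarith [h1 x]
  · rintro ⟨el, eu, ep, lam, p1, p2, p3, p4, p5, R₀, hRm, hRs, hl, hu, hL⟩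
    have hbd : ∀ᵐ ω ∂μ, ∀ i j, |R₀ (ξ (-1) ω) i j| ≤ eu := by
      filter_upwards [hl, hu] with ω a1 a2 i j
      refine psd_entry (hRs _) (fun x => ?_) (fun x => ?_) i j
      · have := psd_qf a1 x
        rw [qf_sub, qf_smul, qf_one] at this
        have := mul_nonneg p1.le (sqNorm_nonneg x)
        linarith
      · have := psd_qf a2 x
        rw [qf_sub, qf_smul, qf_one] at this
        linarith
    set R := trunc eu R₀ with hRdef
    have hR : BM R := trunc_BM p2.le hRm
    have hRR : ∀ t, ∀ᵐ ω ∂μ, R₀ (ξ t ω) = R (ξ t ω) := by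
      intro t
      have := ae_transport μ hξ h2 (-1) t (measurableSet_bd eu hRm) hbd
      filter_upwards [this] with ω hω using (trunc_eq hω).symm
    have tr : ∀ Q : (Fin Z → ℝ) → Matrix (Fin n) (Fin n) ℝ, BM Q →
        (∀ᵐ ω ∂μ, ∀ x, 0 ≤ qf x (Q (ξ (-1) ω))) → ∀ t, ∀ᵐ ω ∂μ, ∀ x, 0 ≤ qf x (Q (ξ t ω)) :=
      fun Q hQ h t => ae_transport μ hξ h2 (-1) t (measurableSet_qf Q hQ.1) h
    have bsub : ∀ P Q : (Fin Z → ℝ) → Matrix (Fin n) (Fin n) ℝ, BM P → BM Q →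
        BM fun v => P v - Q v := by
      intro P Q hP hQ
      rw [BM_iff] at *
      intro i j
      have := (hP i j).add ((BS.const (-1)).mul (hQ i j))
      simpa [sub_eq_add_neg] using this
    have key : ExpStableWith μ B ξ lam := by
      refine core_backward μ hξ h2 hm hB hR p1 p2 ?_ ?_ ?_
      · intro t
        have := tr (fun v => R v - el • (1 : Matrix (Fin n) (Fin n) ℝ))
          (bsub _ _ hR (BM.const _)) (by
            filter_upwards [hl, hRR (-1)] with ω a1 a2 x
            rw [← a2]; exact psd_qf a1 x) t
        filter_upwards [this] with ω hω x
        have := hω x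
        rw [qf_sub, qf_smul, qf_one] at this
        linarith
      · intro t
        have := tr (fun v => eu • (1 : Matrix (Fin n) (Fin n) ℝ) - R v)
          (bsub _ _ (BM.const _) hR) (by
            filter_upwards [hu, hRR (-1)] with ω a1 a2 x
            rw [← a2]; exact psd_qf a1 x) t
        filter_upwards [this] with ω hω x
        have := hω x
        rw [qf_sub, qf_smul, qf_one] at this
        linarith
      · intro t
        have := tr (fun v => lam ^ 2 • R v - LQ (kap μ ξ) B R v)
          (bsub _ _ (hR.smul _) (BM.LQ _ hB hR)) (by
            filter_upwards [hL, hRR (-1), hAB, condExpM_eq μ hξ h2 hR (hRR 0)] with ω a1 a2 a3 a4 x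
            rw [a4, a2, ← a3 (-1)] at a1
            have := psd_qf a1 x
            rw [qf_sub, qf_smul _ ep, qf_one] at this
            have h7 := mul_nonneg p3.le (sqNorm_nonneg x)
            have h8 : 0 ≤ qf x (lam ^ 2 • R (ξ (-1) ω) - (B (ξ (-1) ω))ᵀ
              * KQ (kap μ ξ) R (ξ (-1) ω) * B (ξ (-1) ω)) := by linarith
            exact h8) t
        filter_upwards [this] with ω hω x
        have := hω x
        rw [qf_sub, qf_smul] at this
        linarith
    exact expStable_congr μ hAB ⟨lam, p4, p5, key⟩

end SMS

end
end
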